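/- Let h be a non-erasing morphism on Σ₃* (that is, h(0), h(1), h(2) are all nonempty) and let w : ℕ → Σ₃ be an infinite word with L(w) ⊇ L(h(G)). Then the critical exponent of w is at least μ = 2 + 1/(λ² − 1), where λ is the unique real zero of x³ − 2x² + x − 1; indeed, w contains factors of exponent arbitrarily close to μ. -/

import Mathlib

/-! Common definitions: the alphabet Σ₃, finite and infinite words, factors,
factor complexity, periods and exponents, morphisms, the morphism γ and its
fixed point G = γ^ω(0). -/

abbrev Sigma3 := Fin 3
abbrev Word := List Sigma3
abbrev InfWord := ℕ → Sigma3

/-- `u` is a factor of the infinite word `w`. -/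
def IsFactor (u : Word) (w : InfWord) : Prop :=
  ∃ i : ℕ, u = (List.range u.length).map (fun j => w (i + j))

/-- The set of finite factors of `w`. -/
def Lang (w : InfWord) : Set Word := {u | IsFactor u w}

/-- Factor complexity: the number of distinct length-`n` factors of `w`. -/
noncomputable def complexity (w : InfWord) (n : ℕ) : ℕ :=
  Set.ncard {u : Word | IsFactor u w ∧ u.length = n}

/-- `v` has period `p` (with `p ≥ 1`). -/
def HasPeriod (v : Word) (p : ℕ) : Prop :=
  1 ≤ p ∧ ∀ i, i + p < v.length → v.getD i 0 = v.getD (i + p) 0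

/-- The least period of `v`. -/
noncomputable def minPeriod (v : Word) : ℕ := sInf {p | HasPeriod v p}

/-- The exponent `|v| / p` of a nonempty finite word `v`, where `p` is its least period. -/
noncomputable def expo (v : Word) : ℝ := (v.length : ℝ) / (minPeriod v : ℝ)

/-- `w` contains no factor of exponent `5/2` or greater. -/
def NoFiveHalves (w : InfWord) : Prop :=
  ∀ u : Word, u ≠ [] → IsFactor u w → expo u < 5 / 2

/-- Apply a morphism (given by the images of the three letters) to a finite word. -/
def applyM (f : Sigma3 → Word) (u : Word) : Word := (u.map f).flatten

/-- The image under `f` of the length-`k` prefix of the infinite word `u`. -/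
def imPrefix (f : Sigma3 → Word) (u : InfWord) (k : ℕ) : Word :=
  applyM f ((List.range k).map u)

/-- The image of an infinite word under a (non-erasing) morphism. -/
def applyMInf (f : Sigma3 → Word) (u : InfWord) : InfWord :=
  fun n => (imPrefix f u (n + 1)).getD n 0

/-- The morphism `γ = [01, 2, 02]`. -/
def gam : Sigma3 → Word := ![[0, 1], [2], [0, 2]]

/-- The fixed point `G = γ^ω(0)` of `γ`, the unique infinite fixed point beginning with 0. -/
def G : InfWord := fun n => ((applyM gam)^[n + 1] [0]).getD n 0

/-- The final segment of `w` starting at position `k`. -/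
def shift (w : InfWord) (k : ℕ) : InfWord := fun i => w (i + k)

/-- The reverse `h^R` of a morphism `h`. -/
def mR (f : Sigma3 → Word) : Sigma3 → Word := fun x => (f x).reverse

/-! ### Words and morphisms -/

lemma applyM_append (f : Sigma3 → Word) (u v : Word) :
    applyM f (u ++ v) = applyM f u ++ applyM f v := by
  simp [applyM]

/-- The square of the morphism `γ`. -/
def gamSq : Sigma3 → Word := ![[0, 1, 2], [0, 2], [0, 1, 0, 2]]

lemma applyM_gam_gam (u : Word) : applyM gam (applyM gam u) = applyM gamSq u := by
  induction u with
  | nil => rfl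
  | cons a u ih =>
    rw [← List.singleton_append, applyM_append, applyM_append, ih, applyM_append]
    congr 1
    fin_cases a <;> rfl

lemma applyM_gamSq_eq_cons {u : Word} (hu : u ≠ []) :
    ∃ t, t ≠ [] ∧ applyM gamSq u = 0 :: t := by
  obtain ⟨a, v, rfl⟩ := List.exists_cons_of_ne_nil hu
  fin_cases a <;> simp [applyM, gamSq]

lemma applyM_gamSq_eq_concat {u : Word} (hu : u ≠ []) :
    ∃ t, t ≠ [] ∧ applyM gamSq u = t ++ [2] := by
  obtain ⟨v, a, rfl⟩ := List.eq_nil_or_concat u |>.resolve_left hu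
  rw [List.concat_eq_append, applyM_append]
  fin_cases a
  · exact ⟨applyM gamSq v ++ [0, 1], by simp, by simp [applyM, gamSq]⟩
  · exact ⟨applyM gamSq v ++ [0], by simp, by simp [applyM, gamSq]⟩
  · exact ⟨applyM gamSq v ++ [0, 1, 0], by simp, by simp [applyM, gamSq]⟩

lemma applyM_length_ge {f : Sigma3 → Word} (hf : ∀ x, f x ≠ []) (u : Word) :
    u.length ≤ (applyM f u).length := by
  induction u with
  | nil => simp
  | cons a u ih =>
    have := List.length_pos_iff.2 (hf a)
    rw [← List.singleton_append, applyM_append]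
    simp only [List.length_append, List.length_singleton]
    simp only [applyM, List.map_cons, List.map_nil, List.flatten_cons, List.flatten_nil,
      List.append_nil] at ih ⊢
    omega

/-! ### Limits of chains of prefixes -/

lemma chain_prefix_of_le {c : ℕ → Word} (hc : ∀ k, c k <+: c (k + 1)) {m n : ℕ} (hmn : m ≤ n) :
    c m <+: c n := by
  induction n, hmn using Nat.le_induction with
  | base => exact List.prefix_rfl
  | succ n _ ih => exact ih.trans (hc n)

lemma chain_eq_map_range {c : ℕ → Word} (hc : ∀ k, c k <+: c (k + 1))
    (hlen : ∀ k, k ≤ (c k).length) (m : ℕ) :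
    c m = (List.range (c m).length).map (fun n => (c (n + 1)).getD n 0) := by
  apply List.ext_getElem
  · simp
  intro i hi _
  have hi' : i < (c (i + 1)).length := hlen (i + 1)
  simp only [List.getElem_map, List.getElem_range, List.getD_eq_getElem _ _ hi']
  rcases le_total m (i + 1) with hle | hle
  · exact (chain_prefix_of_le hc hle).getElem hi
  · exact ((chain_prefix_of_le hc hle).getElem hi').symm

lemma isFactor_of_infix_map_range {w : InfWord} {u : Word} {N : ℕ}
    (hu : u <:+: (List.range N).map w) : IsFactor u w := by
  obtain ⟨a, b, hab⟩ := hu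
  refine ⟨a.length, ?_⟩
  apply List.ext_getElem
  · simp
  intro i hi _
  have hN : (a ++ u ++ b).length = N := by rw [hab]; simp
  have hiN : a.length + i < (a ++ u ++ b).length := by
    simp only [List.length_append]; omega
  have key : (a ++ u ++ b)[a.length + i] = w (a.length + i) := by
    simp only [hab, List.getElem_map, List.getElem_range]
  simp only [List.getElem_map, List.getElem_range]
  rw [← key, List.getElem_append_left (by simp; omega), List.getElem_append_right (by omega)]
  simp

lemma gam_iterate_prefix_succ (k : ℕ) : (applyM gam)^[k] [0] <+: (applyM gam)^[k + 1] [0] := by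
  induction k with
  | zero => exact ⟨[1], rfl⟩
  | succ k ih =>
    obtain ⟨t, ht⟩ := ih
    refine ⟨applyM gam t, ?_⟩
    rw [Function.iterate_succ_apply' _ (k + 1), ← ht, applyM_append, ht,
      Function.iterate_succ_apply' _ k]

lemma gam_iterate_length (k : ℕ) :
    ∃ t, (applyM gam)^[k] [0] = 0 :: t ∧ k ≤ t.length := by
  induction k with
  | zero => exact ⟨[], rfl, le_rfl⟩
  | succ k ih =>
    obtain ⟨t, ht, hk⟩ := ih
    refine ⟨1 :: applyM gam t, ?_, ?_⟩
    · rw [Function.iterate_succ_apply', ht]; rfl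
    · have : t.length ≤ (applyM gam t).length :=
        applyM_length_ge (fun x => by fin_cases x <;> simp [gam]) t
      simp only [List.length_cons]; omega

lemma gam_iterate_eq_map_range (m : ℕ) :
    (applyM gam)^[m] [0] = (List.range ((applyM gam)^[m] [0]).length).map G :=
  chain_eq_map_range gam_iterate_prefix_succ
    (fun k => by obtain ⟨t, ht, hk⟩ := gam_iterate_length k; rw [ht]; simp; omega) m

lemma imPrefix_eq_map_range {h : Sigma3 → Word} (hne : ∀ x, h x ≠ []) (u : InfWord) (m : ℕ) :
    imPrefix h u m = (List.range (imPrefix h u m).length).map (applyMInf h u) := by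
  refine chain_eq_map_range (c := imPrefix h u) (fun k => ?_) (fun k => ?_) m
  · refine ⟨h (u k), ?_⟩
    simp [imPrefix, List.range_succ, applyM]
  · simpa [imPrefix] using applyM_length_ge hne ((List.range k).map u)

lemma applyM_isFactor {h : Sigma3 → Word} (hne : ∀ x, h x ≠ []) {u : Word} {m : ℕ}
    (hu : u <:+: (applyM gam)^[m] [0]) : IsFactor (applyM h u) (applyMInf h G) := by
  obtain ⟨a, b, hab⟩ := hu
  refine isFactor_of_infix_map_range (N := (imPrefix h G ((applyM gam)^[m] [0]).length).length) ?_
  rw [← imPrefix_eq_map_range hne, imPrefix, ← gam_iterate_eq_map_range, ← hab, applyM_append,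
    applyM_append]
  exact ⟨_, _, rfl⟩

/-! ### Periods -/

lemma hasPeriod_of_append_eq {u v s : Word} (hv : v ≠ []) (hvs : v ++ u = u ++ s) :
    HasPeriod u v.length := by
  refine ⟨List.length_pos_iff.2 hv, fun i hi => ?_⟩
  have h₁ : (v ++ u).getD (i + v.length) 0 = u.getD i 0 := by
    rw [List.getD_append_right _ _ _ _ (by omega), Nat.add_sub_cancel]
  rw [← h₁, hvs, List.getD_append _ _ _ _ hi]

lemma div_le_expo {u : Word} {p : ℕ} (hp : HasPeriod u p) : (u.length : ℝ) / p ≤ expo u := by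
  have hmem : HasPeriod u (minPeriod u) := Nat.sInf_mem (s := {p | HasPeriod u p}) ⟨p, hp⟩
  have hle : minPeriod u ≤ p := Nat.sInf_le hp
  have hpos : (0 : ℝ) < minPeriod u := by exact_mod_cast hmem.1
  unfold expo
  gcongr

/-! ### Weights -/

/-- The total weight of a word, given the weights of the letters. -/
def weight (l : Sigma3 → ℕ) (u : Word) : ℕ := (u.map l).sum

/-- The letter weights obtained by weighing the images of the letters under `γ²`. -/
def weightSq (l : Sigma3 → ℕ) : Sigma3 → ℕ := fun x => weight l (gamSq x)

/-- The weight of `γ^(2n)(20)`. -/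
def periodWeight (l : Sigma3 → ℕ) (n : ℕ) : ℕ := weight (weightSq^[n] l) [2, 0]

lemma weight_append (l : Sigma3 → ℕ) (u v : Word) :
    weight l (u ++ v) = weight l u + weight l v := by
  simp [weight]

lemma weight_cons (l : Sigma3 → ℕ) (a : Sigma3) (u : Word) :
    weight l (a :: u) = l a + weight l u := by
  simp [weight]

lemma weight_nil (l : Sigma3 → ℕ) : weight l [] = 0 := rfl

lemma length_applyM (f : Sigma3 → Word) (u : Word) :
    (applyM f u).length = weight (fun x => (f x).length) u := by
  simp [applyM, weight, List.length_flatten, Function.comp_def]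

lemma weight_applyM_gamSq (l : Sigma3 → ℕ) (u : Word) :
    weight l (applyM gamSq u) = weight (weightSq l) u := by
  induction u with
  | nil => rfl
  | cons a u ih =>
    rw [← List.singleton_append, applyM_append, weight_append, weight_append, ih]
    simp [applyM, weightSq, weight_cons, weight_nil]

lemma periodWeight_weightSq (l : Sigma3 → ℕ) (n : ℕ) :
    periodWeight (weightSq l) n = periodWeight l (n + 1) := by
  rw [periodWeight, periodWeight, Function.iterate_succ_apply]

/-- The repetitions in `G`: squares of conjugates of `γ^(2n)(20)`, maximally extended. -/
def repWord : ℕ → Word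
  | 0 => [2, 0, 2, 0]
  | n + 1 => 2 :: (applyM gamSq (repWord n) ++ [0])

lemma weight_repWord (l : Sigma3 → ℕ) (n : ℕ) :
    weight l (repWord n) = 2 * periodWeight l n + ∑ k ∈ Finset.range n, periodWeight l k := by
  induction n generalizing l with
  | zero =>
    simp only [repWord, periodWeight, weight_cons, weight_nil, Function.iterate_zero, id,
      Finset.range_zero, Finset.sum_empty]
    ring
  | succ n ih =>
    rw [repWord, weight_cons, weight_append, weight_applyM_gamSq, ih, Finset.sum_range_succ']
    simp only [periodWeight_weightSq]
    simp only [weight_cons, weight_nil, periodWeight, Function.iterate_zero, id]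
    ring

lemma repWord_occurs (n : ℕ) :
    ∃ m a b, a ≠ [] ∧ b ≠ [] ∧ (applyM gam)^[m] [0] = a ++ repWord n ++ b := by
  induction n with
  | zero => exact ⟨4, [0, 1], [1, 0, 2], by simp, by simp, rfl⟩
  | succ n ih =>
    obtain ⟨m, a, b, ha, hb, hm⟩ := ih
    obtain ⟨a', ha', hae⟩ := applyM_gamSq_eq_concat ha
    obtain ⟨b', hb', hbe⟩ := applyM_gamSq_eq_cons hb
    refine ⟨m + 2, a', b', ha', hb', ?_⟩
    rw [Function.iterate_succ_apply', Function.iterate_succ_apply', applyM_gam_gam, hm,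
      applyM_append, applyM_append, hae, hbe, repWord]
    simp

lemma repWord_period (n : ℕ) :
    ∃ v s, v ≠ [] ∧ v ++ repWord n = repWord n ++ s ∧ ∀ l, weight l v = periodWeight l n := by
  induction n with
  | zero => exact ⟨[2, 0], [2, 0], by simp, rfl, fun l => rfl⟩
  | succ n ih =>
    obtain ⟨v, s, hv, hvs, hw⟩ := ih
    have hs : s ≠ [] := by
      rintro rfl
      simp [hv] at hvs
    obtain ⟨v', hv', hve⟩ := applyM_gamSq_eq_concat hv
    obtain ⟨s', hs', hse⟩ := applyM_gamSq_eq_cons hs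
    have hmap := congrArg (applyM gamSq) hvs
    rw [applyM_append, applyM_append, hve, hse] at hmap
    refine ⟨2 :: v', s' ++ [0], by simp, ?_, fun l => ?_⟩
    · have := congrArg (fun t => 2 :: (t ++ [0])) hmap
      simpa [repWord] using this
    · rw [← periodWeight_weightSq, ← hw, ← weight_applyM_gamSq, hve, weight_append, weight_cons,
        weight_cons, weight_nil]
      ring

lemma weightSq_iterate_succ (l : Sigma3 → ℕ) (n : ℕ) :
    (weightSq^[n + 1] l) 0 = (weightSq^[n] l) 0 + (weightSq^[n] l) 1 + (weightSq^[n] l) 2 ∧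
    (weightSq^[n + 1] l) 1 = (weightSq^[n] l) 0 + (weightSq^[n] l) 2 ∧
    (weightSq^[n + 1] l) 2 =
      2 * (weightSq^[n] l) 0 + (weightSq^[n] l) 1 + (weightSq^[n] l) 2 := by
  rw [Function.iterate_succ_apply']
  refine ⟨?_, ?_, ?_⟩ <;> simp [weightSq, gamSq, weight] <;> ring

lemma periodWeight_eq (l : Sigma3 → ℕ) (n : ℕ) :
    periodWeight l n = (weightSq^[n] l) 2 + (weightSq^[n] l) 0 := by
  simp [periodWeight, weight]

lemma periodWeight_rec (l : Sigma3 → ℕ) (n : ℕ) :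
    periodWeight l (n + 3) =
      2 * periodWeight l (n + 2) + 3 * periodWeight l (n + 1) + periodWeight l n := by
  simp only [periodWeight_eq]
  have h₀ := weightSq_iterate_succ l n
  have h₁ := weightSq_iterate_succ l (n + 1)
  have h₂ := weightSq_iterate_succ l (n + 2)
  simp only [add_assoc, Nat.reduceAdd] at h₀ h₁ h₂ ⊢
  omega

lemma two_mul_periodWeight_le (l : Sigma3 → ℕ) (n : ℕ) :
    2 * periodWeight l n ≤ periodWeight l (n + 1) := by
  simp only [periodWeight_eq]
  have h₀ := weightSq_iterate_succ l n
  omega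

/-! ### Asymptotics -/

lemma abs_bounded_of_recurrence {D : ℕ → ℝ} {α β : ℝ} (hβ : β ≤ 1)
    (hαβ : α ^ 2 < 4 * β) (hD : ∀ n, D (n + 2) = -α * D (n + 1) - β * D n) :
    ∃ C, ∀ n, |D n| ≤ C := by
  set Q : ℕ → ℝ := fun n => D (n + 1) ^ 2 + α * D n * D (n + 1) + β * D n ^ 2 with hQ
  have hpos : ∀ n, (β - α ^ 2 / 4) * D n ^ 2 ≤ Q n := fun n => by
    have := sq_nonneg (D (n + 1) + α / 2 * D n)
    simp only [hQ]
    linarith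
  have hc : 0 < β - α ^ 2 / 4 := by linarith
  have hstep : ∀ n, Q (n + 1) = β * Q n := fun n => by
    simp only [hQ, hD]
    ring
  have hle : ∀ n, Q n ≤ Q 0 := fun n => by
    induction n with
    | zero => exact le_rfl
    | succ n ih =>
      have : 0 ≤ Q n := le_trans (by positivity) (hpos n)
      rw [hstep]
      nlinarith
  refine ⟨√(Q 0 / (β - α ^ 2 / 4)), fun n => Real.abs_le_sqrt ?_⟩
  rw [le_div_iff₀ hc]
  linarith [hpos n, hle n]

lemma exists_mul_lt_of_recurrence {P : ℕ → ℝ} {θ : ℝ}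
    (hrec : ∀ n, P (n + 3) = 2 * P (n + 2) + 3 * P (n + 1) + P n)
    (hgrow : ∀ n, 2 * P n ≤ P (n + 1)) (hP₀ : 1 ≤ P 0)
    (hθ : θ ^ 3 - 2 * θ ^ 2 - 3 * θ - 1 = 0) (hθ' : 3.079 < θ)
    {x : ℝ} (hx : x < 2 + 1 / (θ - 1)) :
    ∃ n, x * P n < 2 * P n + ∑ k ∈ Finset.range n, P k := by
  obtain ⟨C, hC⟩ := abs_bounded_of_recurrence (D := fun n => P (n + 1) - θ * P n)
    (α := θ - 2) (β := θ ^ 2 - 2 * θ - 3) (by nlinarith) (by nlinarith)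
    (fun n => by
      simp only [hrec]
      linear_combination -P n * hθ)
  have hsum : ∀ n, P n - P 0 - n * C ≤ (θ - 1) * ∑ k ∈ Finset.range n, P k := fun n => by
    induction n with
    | zero => simp
    | succ n ih =>
      have := (abs_le.1 (hC n)).2
      rw [Finset.sum_range_succ]
      push_cast
      linarith
  have hpow : ∀ n, (2 : ℝ) ^ n ≤ P n := fun n => by
    induction n with
    | zero => simpa using hP₀
    | succ n ih => rw [pow_succ]; linarith [hgrow n]
  have hθ₁ : 0 < θ - 1 := by linarith
  set δ := 1 - (x - 2) * (θ - 1) with hδ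
  have hδ₀ : 0 < δ := by
    have : x - 2 < 1 / (θ - 1) := by linarith
    rw [lt_div_iff₀ hθ₁] at this
    linarith
  have hlim : Filter.Tendsto (fun n : ℕ => (P 0 + n * C) / 2 ^ n) Filter.atTop (nhds 0) := by
    have h₁ := (tendsto_pow_const_div_const_pow_of_one_lt 0 (one_lt_two (α := ℝ))).const_mul (P 0)
    have h₂ := (tendsto_pow_const_div_const_pow_of_one_lt 1 (one_lt_two (α := ℝ))).const_mul C
    have h₃ := h₁.add h₂
    simp only [mul_zero, add_zero] at h₃
    refine h₃.congr fun n => ?_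
    ring
  obtain ⟨n, hn⟩ := (hlim.eventually_lt_const hδ₀).exists
  refine ⟨n, ?_⟩
  rw [div_lt_iff₀ (by positivity)] at hn
  have h₁ : δ * 2 ^ n ≤ δ * P n := mul_le_mul_of_nonneg_left (hpow n) hδ₀.le
  have h₂ : (θ - 1) * ((x - 2) * P n) < (θ - 1) * ∑ k ∈ Finset.range n, P k := by
    have : (θ - 1) * ((x - 2) * P n) = P n - δ * P n := by rw [hδ]; ring
    linarith [hsum n]
  linarith [lt_of_mul_lt_mul_left h₂ hθ₁.le]

lemma sq_root_cubic {lam : ℝ} (hlam : lam ^ 3 - 2 * lam ^ 2 + lam - 1 = 0) :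
    (lam ^ 2) ^ 3 - 2 * (lam ^ 2) ^ 2 - 3 * lam ^ 2 - 1 = 0 := by
  linear_combination (lam ^ 3 + 2 * lam ^ 2 + lam + 1) * hlam

lemma lt_root_cubic {θ : ℝ} (hθ₀ : 0 ≤ θ) (hθ : θ ^ 3 - 2 * θ ^ 2 - 3 * θ - 1 = 0) :
    3.079 < θ := by
  by_contra! hle
  have h₁ : θ ^ 2 - 2 * θ - 3 ≤ 0.3223 := by nlinarith
  nlinarith [mul_le_mul_of_nonneg_left h₁ hθ₀]

/-- If `h` is a non-erasing morphism on Σ₃* and `L(w) ⊇ L(h(G))`, then the critical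
exponent of `w` is at least `μ = 2 + 1/(λ² - 1)`: `w` contains nonempty factors of
exponent exceeding any real number below `μ`. -/
theorem stmt7 (h : Sigma3 → Word) (hne : ∀ x : Sigma3, h x ≠ [])
    (w : InfWord) (hL : Lang (applyMInf h G) ⊆ Lang w)
    (lam : ℝ) (hlam : lam ^ 3 - 2 * lam ^ 2 + lam - 1 = 0) :
    ∀ x : ℝ, x < 2 + 1 / (lam ^ 2 - 1) →
      ∃ u : Word, u ≠ [] ∧ IsFactor u w ∧ x < expo u := by
  intro x hx
  have hθ := sq_root_cubic hlam
  set l : Sigma3 → ℕ := fun c => (h c).length with hl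
  have hpos : 1 ≤ periodWeight l 0 := by
    have := List.length_pos_iff.2 (hne 2)
    simp only [periodWeight_eq, Function.iterate_zero, id, hl]
    omega
  obtain ⟨n, hn⟩ := exists_mul_lt_of_recurrence (P := fun n => (periodWeight l n : ℝ))
    (fun n => by exact_mod_cast periodWeight_rec l n)
    (fun n => by exact_mod_cast two_mul_periodWeight_le l n) (by exact_mod_cast hpos)
    hθ (lt_root_cubic (sq_nonneg lam) hθ) hx
  obtain ⟨m, a, b, -, -, hm⟩ := repWord_occurs n
  obtain ⟨v, s, hv, hvs, hw⟩ := repWord_period n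
  have hlen : (applyM h v).length = periodWeight l n := by rw [length_applyM, hw]
  have hv' : applyM h v ≠ [] := List.length_pos_iff.1 <|
    (List.length_pos_iff.2 hv).trans_le (applyM_length_ge hne v)
  have hper : HasPeriod (applyM h (repWord n)) (periodWeight l n) := by
    rw [← hlen]
    refine hasPeriod_of_append_eq (s := applyM h s) hv' ?_
    rw [← applyM_append, hvs, applyM_append]
  have hP : (0 : ℝ) < periodWeight l n := by exact_mod_cast hper.1
  refine ⟨applyM h (repWord n), ?_, hL (applyM_isFactor hne ⟨a, b, hm.symm⟩), ?_⟩
  · refine List.length_pos_iff.1 (lt_of_lt_of_le ?_ (applyM_length_ge hne _))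
    cases n <;> simp [repWord]
  · refine lt_of_lt_of_le ?_ (div_le_expo hper)
    rw [lt_div_iff₀ hP, length_applyM, weight_repWord]
    push_cast
    exact hn
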